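/- arXiv:1907.06063 — 12 statements merged into one kernel-verified Lean document; each statement's English description precedes it below -/
import Mathlib

section
/- Let f be a flow function of width ℓ. Then for every k with 0 ≤ k < ℓ and every string w = w_0…w_k ∈ Σ^{k+1}, the lower half-flows satisfy f̲_k(w_{1:k}) ≤ f̲_{k+1}(w) ≤ f̲_k(w_{0:k}) + #w_k, where w_{0:k} = w_0…w_{k−1} is the prefix of length k and w_{1:k} = w_1…w_k is the suffix of length k. -/
/-- The state set `Σ = {0, 1, …, C}`. -/
abbrev St (C : ℕ) := Fin (C + 1)

/-- Particle content `#w` of a string `w ∈ Σ^n`. -/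
def content {C n : ℕ} (w : Fin n → St C) : ℤ := ∑ i, (w i : ℤ)

/-- The prefix `w_{0:k}` of a string `w ∈ Σ^{k+1}`. -/
def prefixStr {C k : ℕ} (w : Fin (k + 1) → St C) : Fin k → St C :=
  fun i => w i.castSucc

/-- The suffix `w_{1:k}` of a string `w ∈ Σ^{k+1}`. -/
def suffixStr {C k : ℕ} (w : Fin (k + 1) → St C) : Fin k → St C :=
  fun i => w i.succ

/-- `f : Σ^ℓ → ℤ` is a flow function of width `ℓ`:
`0 ≤ f(w_{0:ℓ}) + #w_ℓ − f(w_{1:ℓ}) ≤ C` for all `w ∈ Σ^{ℓ+1}`. -/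
def IsFlow (C ℓ : ℕ) (f : (Fin ℓ → St C) → ℤ) : Prop :=
  ∀ w : Fin (ℓ + 1) → St C,
    0 ≤ f (prefixStr w) + (w (Fin.last ℓ) : ℤ) - f (suffixStr w) ∧
      f (prefixStr w) + (w (Fin.last ℓ) : ℤ) - f (suffixStr w) ≤ (C : ℤ)

/-- Concatenation `u v` of strings, recast to length `n`. -/
def appendCast {C m k n : ℕ} (h : m + k = n) (u : Fin m → St C) (v : Fin k → St C) :
    Fin n → St C := fun i => Fin.append u v (Fin.cast h.symm i)

/-- Lower half-flow `f̲_k(v) = min { f(uv) : u ∈ Σ^{ℓ−k} }`. -/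
noncomputable def lhf {C ℓ : ℕ} (f : (Fin ℓ → St C) → ℤ) (k : ℕ) (hk : k ≤ ℓ)
    (v : Fin k → St C) : ℤ :=
  Finset.univ.inf' Finset.univ_nonempty
    (fun u : Fin (ℓ - k) → St C => f (appendCast (Nat.sub_add_cancel hk) u v))

/-- Upper half-flow `f̄_k(v) = max { f(uv) : u ∈ Σ^{ℓ−k} }`. -/
noncomputable def uhf {C ℓ : ℕ} (f : (Fin ℓ → St C) → ℤ) (k : ℕ) (hk : k ≤ ℓ)
    (v : Fin k → St C) : ℤ :=
  Finset.univ.sup' Finset.univ_nonempty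
    (fun u : Fin (ℓ - k) → St C => f (appendCast (Nat.sub_add_cancel hk) u v))

theorem lhf_le_of_agree {C ℓ : ℕ} (f : (Fin ℓ → St C) → ℤ) (k : ℕ) (hk : k ≤ ℓ)
    (v : Fin k → St C) (x : Fin ℓ → St C)
    (h : ∀ (i : Fin k) (j : Fin ℓ), (j : ℕ) = ℓ - k + i → x j = v i) :
    lhf f k hk v ≤ f x := by
  have hx : appendCast (Nat.sub_add_cancel hk)
      (fun i : Fin (ℓ - k) => x ⟨i, by omega⟩) v = x := by
    funext j
    obtain ⟨j', rfl⟩ : ∃ j', j = Fin.cast (Nat.sub_add_cancel hk) j' :=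
      ⟨Fin.cast (Nat.sub_add_cancel hk).symm j, by simp⟩
    simp only [appendCast, Fin.cast_cast, Fin.cast_eq_self]
    refine Fin.addCases (fun i => ?_) (fun i => ?_) j'
    · rw [Fin.append_left]; congr 1
    · rw [Fin.append_right]; exact (h i _ (by simp)).symm
  unfold lhf
  have := Finset.inf'_le
    (fun u : Fin (ℓ - k) → St C => f (appendCast (Nat.sub_add_cancel hk) u v))
    (Finset.mem_univ (fun i : Fin (ℓ - k) => x ⟨i, by omega⟩))
  simpa only [hx] using this

theorem exists_lhf_eq {C ℓ : ℕ} (f : (Fin ℓ → St C) → ℤ) (k : ℕ) (hk : k ≤ ℓ)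
    (v : Fin k → St C) : ∃ x : Fin ℓ → St C,
    (∀ (i : Fin k) (j : Fin ℓ), (j : ℕ) = ℓ - k + i → x j = v i) ∧
    lhf f k hk v = f x := by
  obtain ⟨u, -, hu⟩ := Finset.exists_mem_eq_inf' Finset.univ_nonempty
    (fun u : Fin (ℓ - k) → St C => f (appendCast (Nat.sub_add_cancel hk) u v))
  refine ⟨_, ?_, hu⟩
  intro i j hj
  have : Fin.cast (Nat.sub_add_cancel hk).symm j = Fin.natAdd (ℓ - k) i := by
    ext; simpa using hj
  simp only [appendCast, this, Fin.append_right]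

/-- Lemma 1 (interaction of half-flows), lower part:
`f̲_k(w_{1:k}) ≤ f̲_{k+1}(w) ≤ f̲_k(w_{0:k}) + #w_k`. -/
theorem lower_half_flow_recursion (C ℓ : ℕ) (hC : 1 ≤ C) (hℓ : 1 ≤ ℓ)
    (f : (Fin ℓ → St C) → ℤ) (hf : IsFlow C ℓ f)
    (k : ℕ) (hk : k < ℓ) (w : Fin (k + 1) → St C) :
    lhf f k (le_of_lt hk) (suffixStr w) ≤ lhf f (k + 1) hk w ∧
      lhf f (k + 1) hk w ≤ lhf f k (le_of_lt hk) (prefixStr w) + (w (Fin.last k) : ℤ) := by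
  constructor
  · obtain ⟨x, hx, he⟩ := exists_lhf_eq f (k + 1) hk w
    rw [he]
    refine lhf_le_of_agree f k _ _ x fun i j hj => hx i.succ j ?_
    simp only [Fin.val_succ]; omega
  · obtain ⟨x, hx, he⟩ := exists_lhf_eq f k (le_of_lt hk) (prefixStr w)
    rw [he]
    let y : Fin (ℓ + 1) → St C := Fin.snoc (α := fun _ => St C) x (w (Fin.last k))
    have hp : prefixStr y = x := by
      funext i; simp [prefixStr, y]
    have hl : y (Fin.last ℓ) = w (Fin.last k) := by simp [y]
    have h1 := (hf y).1
    rw [hp, hl] at h1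
    have h2 : lhf f (k + 1) hk w ≤ f (suffixStr y) := by
      refine lhf_le_of_agree f (k + 1) _ _ _ fun i j hj => ?_
      unfold suffixStr
      induction i using Fin.lastCases with
      | last =>
        have : j.succ = Fin.last ℓ := by
          ext; simp at hj ⊢; omega
        rw [this, hl]
      | cast i =>
        have hi := i.2
        simp only [Fin.val_castSucc] at hj
        have : j.succ = Fin.castSucc (⟨j + 1, by omega⟩ : Fin ℓ) := by
          ext; simp
        rw [this]
        have h3 := hx i ⟨j + 1, by omega⟩ (by simp only; omega)
        rw [← hp] at h3
        exact h3
    omega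
end

section
/- Let f be a flow function of width ℓ. Then for every k with 0 ≤ k < ℓ and every string w = w_0…w_k ∈ Σ^{k+1}, the upper half-flows satisfy f̄_k(w_{0:k}) − #^c w_k ≤ f̄_{k+1}(w) ≤ f̄_k(w_{1:k}), where w_{0:k} = w_0…w_{k−1} is the prefix of length k and w_{1:k} = w_1…w_k is the suffix of length k. -/
theorem le_uhf_of_suffix {C ℓ : ℕ} (f : (Fin ℓ → St C) → ℤ) (k : ℕ) (hk : k ≤ ℓ)
    (v : Fin k → St C) (x : Fin ℓ → St C)
    (hx : ∀ i : Fin k, x ⟨ℓ - k + i, by omega⟩ = v i) : f x ≤ uhf f k hk v := by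
  have hxe : x = appendCast (Nat.sub_add_cancel hk)
      (fun i : Fin (ℓ - k) => x ⟨i, by omega⟩) v := by
    funext j
    unfold appendCast
    obtain ⟨j', rfl⟩ : ∃ j' : Fin (ℓ - k + k), j = Fin.cast (Nat.sub_add_cancel hk) j' :=
      ⟨Fin.cast (Nat.sub_add_cancel hk).symm j, by ext; simp⟩
    induction j' using Fin.addCases with
    | left i => simp; rfl
    | right i => simp; rw [← hx i]; rfl
  rw [hxe]
  exact Finset.le_sup' (fun u : Fin (ℓ - k) → St C =>
    f (appendCast (Nat.sub_add_cancel hk) u v)) (Finset.mem_univ _)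

theorem exists_uhf_eq {C ℓ : ℕ} (f : (Fin ℓ → St C) → ℤ) (k : ℕ) (hk : k ≤ ℓ)
    (v : Fin k → St C) : ∃ x : Fin ℓ → St C,
    (∀ i : Fin k, x ⟨ℓ - k + i, by omega⟩ = v i) ∧ uhf f k hk v = f x := by
  obtain ⟨u, -, hu⟩ := Finset.exists_mem_eq_sup' Finset.univ_nonempty
    (fun u : Fin (ℓ - k) → St C => f (appendCast (Nat.sub_add_cancel hk) u v))
  refine ⟨_, fun i => ?_, hu⟩
  exact Fin.append_right u v i

/-- Lemma 1 (interaction of half-flows), upper part: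
`f̄_k(w_{0:k}) − #^c w_k ≤ f̄_{k+1}(w) ≤ f̄_k(w_{1:k})`. -/
theorem upper_half_flow_recursion (C ℓ : ℕ) (hC : 1 ≤ C) (hℓ : 1 ≤ ℓ)
    (f : (Fin ℓ → St C) → ℤ) (hf : IsFlow C ℓ f)
    (k : ℕ) (hk : k < ℓ) (w : Fin (k + 1) → St C) :
    uhf f k (le_of_lt hk) (prefixStr w) - ((C : ℤ) - (w (Fin.last k) : ℤ)) ≤ uhf f (k + 1) hk w ∧
      uhf f (k + 1) hk w ≤ uhf f k (le_of_lt hk) (suffixStr w) := by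
  constructor
  · obtain ⟨x, hx, he⟩ := exists_uhf_eq f k (le_of_lt hk) (prefixStr w)
    rw [he]
    have h := (hf (Fin.snoc x (w (Fin.last k)))).2
    have hp : prefixStr (Fin.snoc x (w (Fin.last k)) : Fin (ℓ + 1) → St C) = x := by
      funext i; simp [prefixStr]
    have hs := le_uhf_of_suffix f (k + 1) hk w
      (suffixStr (Fin.snoc x (w (Fin.last k)) : Fin (ℓ + 1) → St C)) (by
        intro i
        induction i using Fin.lastCases with
        | last =>
          have : (⟨ℓ - (k + 1) + (Fin.last k : ℕ), by simp; omega⟩ : Fin ℓ).succ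
              = Fin.last ℓ := by ext; simp; omega
          simp only [suffixStr, this, Fin.snoc_last]
        | cast i =>
          have : (⟨ℓ - (k + 1) + (i.castSucc : ℕ), by simp; omega⟩ : Fin ℓ).succ
              = (⟨ℓ - k + i, by omega⟩ : Fin ℓ).castSucc := by ext; simp; omega
          simp only [suffixStr, this, Fin.snoc_castSucc]
          exact hx i)
    rw [hp, Fin.snoc_last] at h
    linarith
  · obtain ⟨x, hx, he⟩ := exists_uhf_eq f (k + 1) hk w
    rw [he]
    refine le_uhf_of_suffix f k (le_of_lt hk) (suffixStr w) x fun i => ?_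
    rw [suffixStr, ← hx i.succ]
    congr 1
    ext
    simp
    omega
end

section
/- Let f be a flow function of width ℓ. Then for every k with 0 ≤ k ≤ ℓ and every v ∈ Σ^k, the half-flows satisfy f̲_k(v) ≤ f̄_k(v) ≤ f̲_k(v) + (ℓ − k)·C. -/
/-- Extend a string by zeros. -/
def extZero {C l : ℕ} (a : Fin l → St C) : ℕ → St C :=
  fun i => if h : i < l then a ⟨i, h⟩ else 0

theorem shift_bound {C l : ℕ} (f : (Fin l → St C) → ℤ) (hf : IsFlow C l f)
    (a : Fin l → St C) (n : ℕ) :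
    f (fun i => extZero a (n + i)) ≤ f a ∧
      f a ≤ f (fun i => extZero a (n + i)) + (n : ℤ) * C := by
  induction n with
  | zero =>
    have : (fun i : Fin l => extZero a (0 + i)) = a := by
      funext i
      simp [extZero]
    rw [this]
    simp
  | succ n ih =>
    have h := hf (fun i => extZero a (n + i))
    have h1 : prefixStr (fun i : Fin (l + 1) => extZero a (n + i))
        = fun i : Fin l => extZero a (n + i) := by
      funext i
      simp [prefixStr]
    have h2 : suffixStr (fun i : Fin (l + 1) => extZero a (n + i))
        = fun i : Fin l => extZero a (n + 1 + i) := by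
      funext i
      simp only [suffixStr, Fin.val_succ]
      congr 1
      omega
    have h3 : extZero a (n + (Fin.last l : Fin (l + 1))) = 0 := by
      simp [extZero]
    rw [h1, h2] at h
    simp only [h3] at h
    simp only [Fin.val_zero, Nat.cast_zero] at h
    push_cast
    constructor
    · linarith [h.1, ih.1]
    · linarith [h.2, ih.2]

theorem shift_eq {C m k l : ℕ} (h : m + k = l) (u u' : Fin m → St C) (v : Fin k → St C) :
    (fun i : Fin l => extZero (appendCast h u v) (m + i))
      = fun i : Fin l => extZero (appendCast h u' v) (m + i) := by
  subst h
  funext i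
  by_cases hi : m + (i : ℕ) < m + k
  · have e : (⟨m + (i : ℕ), hi⟩ : Fin (m + k)) = Fin.natAdd m ⟨i, by omega⟩ := rfl
    simp only [extZero, hi, dif_pos, appendCast, Fin.cast_eq_self, e, Fin.append_right]
  · simp only [extZero, hi, dif_neg, not_false_eq_true]

/-- Lemma 2 (bounds on the half-flows): `f̲_k(v) ≤ f̄_k(v) ≤ f̲_k(v) + (ℓ−k)·C`. -/
theorem half_flow_distance_bounds (C ℓ : ℕ) (hC : 1 ≤ C) (hℓ : 1 ≤ ℓ)
    (f : (Fin ℓ → St C) → ℤ) (hf : IsFlow C ℓ f)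
    (k : ℕ) (hk : k ≤ ℓ) (v : Fin k → St C) :
    lhf f k hk v ≤ uhf f k hk v ∧ uhf f k hk v ≤ lhf f k hk v + ((ℓ - k : ℕ) : ℤ) * C := by
  have key : ∀ u u' : Fin (ℓ - k) → St C,
      f (appendCast (Nat.sub_add_cancel hk) u v) ≤
        f (appendCast (Nat.sub_add_cancel hk) u' v) + ((ℓ - k : ℕ) : ℤ) * C := by
    intro u u'
    have h1 := (shift_bound f hf (appendCast (Nat.sub_add_cancel hk) u v) (ℓ - k)).2
    have h2 := (shift_bound f hf (appendCast (Nat.sub_add_cancel hk) u' v) (ℓ - k)).1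
    rw [shift_eq (Nat.sub_add_cancel hk) u u' v] at h1
    linarith
  constructor
  · unfold lhf uhf
    exact (Finset.inf'_le _ (Finset.mem_univ (fun _ => 0))).trans
      (Finset.le_sup' (fun u : Fin (ℓ - k) → St C =>
        f (appendCast (Nat.sub_add_cancel hk) u v)) (Finset.mem_univ (fun _ => 0)))
  · obtain ⟨u', -, hu'⟩ := Finset.exists_mem_eq_inf' Finset.univ_nonempty
      (fun u : Fin (ℓ - k) → St C => f (appendCast (Nat.sub_add_cancel hk) u v))
    unfold lhf uhf
    rw [hu']
    exact Finset.sup'_le _ _ (fun u _ => key u u')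
end

section
/- Let f be a flow function of width ℓ. Then for every k with 1 ≤ k ≤ ℓ and every string w = w_0…w_k ∈ Σ^{k+1}, the half-flows satisfy the split flow conditions: 0 ≤ f̲_k(w_{0:k}) + #w_k − f̲_k(w_{1:k}) and f̄_k(w_{0:k}) + #w_k − f̄_k(w_{1:k}) ≤ C, where w_{0:k} = w_0…w_{k−1} and w_{1:k} = w_1…w_k. -/
/-- Any extension `u w_{0:k}` is followed by some `u' w_{1:k}` obeying the flow conditions. -/
theorem exists_next {C ℓ : ℕ} (f : (Fin ℓ → St C) → ℤ) (hf : IsFlow C ℓ f)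
    (k : ℕ) (hk : k ≤ ℓ) (w : Fin (k + 1) → St C) (u : Fin (ℓ - k) → St C) :
    ∃ u' : Fin (ℓ - k) → St C,
      0 ≤ f (appendCast (Nat.sub_add_cancel hk) u (prefixStr w)) + (w (Fin.last k) : ℤ)
        - f (appendCast (Nat.sub_add_cancel hk) u' (suffixStr w)) ∧
      f (appendCast (Nat.sub_add_cancel hk) u (prefixStr w)) + (w (Fin.last k) : ℤ)
        - f (appendCast (Nat.sub_add_cancel hk) u' (suffixStr w)) ≤ (C : ℤ) := by
  let U : Fin (ℓ + 1) → St C := fun j =>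
    if h : (j : ℕ) < ℓ - k then u ⟨j, h⟩ else w ⟨j - (ℓ - k), by omega⟩
  let u' : Fin (ℓ - k) → St C := fun i => U ⟨i + 1, by omega⟩
  have h1 : prefixStr U = appendCast (Nat.sub_add_cancel hk) u (prefixStr w) := by
    funext i
    by_cases h : (i : ℕ) < ℓ - k
    · simp [prefixStr, appendCast, U, Fin.append, Fin.addCases, h, Fin.castLT]
    · simp [prefixStr, appendCast, U, Fin.append, Fin.addCases, h, Fin.subNat]
  have h2 : suffixStr U = appendCast (Nat.sub_add_cancel hk) u' (suffixStr w) := by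
    funext i
    by_cases h : (i : ℕ) < ℓ - k
    · simp [suffixStr, appendCast, u', Fin.append, Fin.addCases, h, Fin.castLT, Fin.succ]
    · have h' : ¬ ((i : ℕ) + 1 < ℓ - k) := by omega
      have e : (i : ℕ) + 1 - (ℓ - k) = i - (ℓ - k) + 1 := by omega
      simp [suffixStr, appendCast, U, Fin.append, Fin.addCases, h, h', Fin.subNat, e]
  have h3 : U (Fin.last ℓ) = w (Fin.last k) := by
    have h' : ¬ (ℓ < ℓ - k) := by omega
    have e : ℓ - (ℓ - k) = k := by omega
    simp [U, h', e, Fin.last]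
  refine ⟨u', ?_⟩
  have := hf U
  rwa [h1, h2, h3] at this

/-- The split flow conditions for the half-flows:
`0 ≤ f̲_k(w_{0:k}) + #w_k − f̲_k(w_{1:k})` and `f̄_k(w_{0:k}) + #w_k − f̄_k(w_{1:k}) ≤ C`. -/
theorem half_flow_split_conditions (C ℓ : ℕ) (hC : 1 ≤ C) (hℓ : 1 ≤ ℓ)
    (f : (Fin ℓ → St C) → ℤ) (hf : IsFlow C ℓ f)
    (k : ℕ) (hk1 : 1 ≤ k) (hk : k ≤ ℓ) (w : Fin (k + 1) → St C) :
    0 ≤ lhf f k hk (prefixStr w) + (w (Fin.last k) : ℤ) - lhf f k hk (suffixStr w) ∧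
      uhf f k hk (prefixStr w) + (w (Fin.last k) : ℤ) - uhf f k hk (suffixStr w) ≤ (C : ℤ) := by
  constructor
  · obtain ⟨u, -, hu⟩ := Finset.exists_mem_eq_inf' Finset.univ_nonempty
      (fun u : Fin (ℓ - k) → St C => f (appendCast (Nat.sub_add_cancel hk) u (prefixStr w)))
    obtain ⟨u', h, -⟩ := exists_next f hf k hk w u
    have h2 : lhf f k hk (suffixStr w) ≤
        f (appendCast (Nat.sub_add_cancel hk) u' (suffixStr w)) :=
      Finset.inf'_le _ (Finset.mem_univ u')
    have h3 : lhf f k hk (prefixStr w) =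
        f (appendCast (Nat.sub_add_cancel hk) u (prefixStr w)) := hu
    linarith
  · obtain ⟨u, -, hu⟩ := Finset.exists_mem_eq_sup' Finset.univ_nonempty
      (fun u : Fin (ℓ - k) → St C => f (appendCast (Nat.sub_add_cancel hk) u (prefixStr w)))
    obtain ⟨u', -, h⟩ := exists_next f hf k hk w u
    have h2 : f (appendCast (Nat.sub_add_cancel hk) u' (suffixStr w)) ≤
        uhf f k hk (suffixStr w) :=
      Finset.le_sup' (fun u : Fin (ℓ - k) → St C =>
        f (appendCast (Nat.sub_add_cancel hk) u (suffixStr w))) (Finset.mem_univ u')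
    have h3 : uhf f k hk (prefixStr w) =
        f (appendCast (Nat.sub_add_cancel hk) u (prefixStr w)) := hu
    linarith
end

section
/- Fix 0 ≤ k < ℓ and suppose g, G : Σ^k → ℤ satisfy, for all v ∈ Σ^k: 0 ≤ g(v) ≤ #v, 0 ≤ G(v) ≤ (ℓ−k)·C + #v, and g(v) ≤ G(v) ≤ g(v) + (ℓ−k)·C, and, for all w = w_0…w_k ∈ Σ^{k+1}: g(w_{1:k}) ≤ g(w_{0:k}) + #w_k and G(w_{0:k}) − #^c w_k ≤ G(w_{1:k}). Then there exist g', G' : Σ^{k+1} → ℤ such that for all v = v_0…v_k ∈ Σ^{k+1}: g(v_{1:k}) ≤ g'(v) ≤ g(v_{0:k}) + #v_k; 0 ≤ g'(v) ≤ #v; G(v_{0:k}) − #^c v_k ≤ G'(v) ≤ G(v_{1:k}); 0 ≤ G'(v) ≤ #v + (ℓ−k−1)·C; and g'(v) ≤ G'(v) ≤ g'(v) + (ℓ−k−1)·C. (Here v_{0:k} = v_0…v_{k−1} and v_{1:k} = v_1…v_k.) -/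
/-- The induction step of the flow construction (Theorem 1): a pair of half-flow
candidates `(g, G)` at level `k` satisfying the half-flow inequalities can always
be extended to a pair `(g', G')` at level `k + 1`. -/
theorem flow_construction_step (C ℓ : ℕ) (hC : 1 ≤ C) (hℓ : 1 ≤ ℓ)
    (k : ℕ) (hk : k < ℓ) (g G : (Fin k → St C) → ℤ)
    (hbounds : ∀ v : Fin k → St C,
      (0 ≤ g v ∧ g v ≤ content v) ∧
      (0 ≤ G v ∧ G v ≤ ((ℓ - k : ℕ) : ℤ) * C + content v) ∧
      (g v ≤ G v ∧ G v ≤ g v + ((ℓ - k : ℕ) : ℤ) * C))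
    (hsplit : ∀ w : Fin (k + 1) → St C,
      g (suffixStr w) ≤ g (prefixStr w) + (w (Fin.last k) : ℤ) ∧
      G (prefixStr w) - ((C : ℤ) - (w (Fin.last k) : ℤ)) ≤ G (suffixStr w)) :
    ∃ g' G' : (Fin (k + 1) → St C) → ℤ, ∀ v : Fin (k + 1) → St C,
      (g (suffixStr v) ≤ g' v ∧ g' v ≤ g (prefixStr v) + (v (Fin.last k) : ℤ)) ∧
      (0 ≤ g' v ∧ g' v ≤ content v) ∧
      (G (prefixStr v) - ((C : ℤ) - (v (Fin.last k) : ℤ)) ≤ G' v ∧ G' v ≤ G (suffixStr v)) ∧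
      (0 ≤ G' v ∧ G' v ≤ content v + ((ℓ - (k + 1) : ℕ) : ℤ) * C) ∧
      (g' v ≤ G' v ∧ G' v ≤ g' v + ((ℓ - (k + 1) : ℕ) : ℤ) * C) := by
  set M : ℤ := ((ℓ - (k + 1) : ℕ) : ℤ) * C with hM
  have hM0 : 0 ≤ M := by positivity
  have hMC : ((ℓ - k : ℕ) : ℤ) * C = M + C := by
    have h : ℓ - k = (ℓ - (k + 1)) + 1 := by omega
    rw [hM, h]
    push_cast
    ring
  rw [hMC] at hbounds
  clear_value M
  refine ⟨fun v => max (g (suffixStr v))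
      (G (prefixStr v) - ((C : ℤ) - (v (Fin.last k) : ℤ)) - M),
    fun v => max (max (g (suffixStr v))
      (G (prefixStr v) - ((C : ℤ) - (v (Fin.last k) : ℤ)) - M))
      (G (prefixStr v) - ((C : ℤ) - (v (Fin.last k) : ℤ))), fun v => ?_⟩
  have hc : content v = content (prefixStr v) + (v (Fin.last k) : ℤ) := by
    simp only [content, prefixStr]
    exact Fin.sum_univ_castSucc _
  have h1 := hbounds (prefixStr v)
  have h2 := hbounds (suffixStr v)
  have h3 := hsplit v
  dsimp only
  rw [hc]
  omega
end

section
/- Suppose (g_k, G_k)_{0 ≤ k ≤ ℓ} is a sequence of functions g_k, G_k : Σ^k → ℤ such that: for all 0 ≤ k < ℓ and w = w_0…w_k ∈ Σ^{k+1}, g_k(w_{1:k}) ≤ g_{k+1}(w) ≤ g_k(w_{0:k}) + #w_k and G_k(w_{0:k}) − #^c w_k ≤ G_{k+1}(w) ≤ G_k(w_{1:k}); and for all 0 ≤ k ≤ ℓ and v ∈ Σ^k, 0 ≤ g_k(v) ≤ #v, 0 ≤ G_k(v) ≤ (ℓ−k)·C + #v, and g_k(v) ≤ G_k(v) ≤ g_k(v)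 + (ℓ−k)·C. Then g_ℓ = G_ℓ, and f = g_ℓ is a flow function of width ℓ, i.e., it satisfies the flow conditions. -/
/-- Theorem 1 (flow construction), completion: a full sequence of half-flow
candidates `(g_k, G_k)_{0 ≤ k ≤ ℓ}` satisfying the half-flow inequalities ends
with `g_ℓ = G_ℓ`, and `f = g_ℓ` is a flow function of width `ℓ`. -/
theorem flow_construction_limit (C ℓ : ℕ) (hC : 1 ≤ C) (hℓ : 1 ≤ ℓ)
    (g G : (k : ℕ) → (Fin k → St C) → ℤ)
    (hrec : ∀ k, k < ℓ → ∀ w : Fin (k + 1) → St C,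
      (g k (suffixStr w) ≤ g (k + 1) w ∧
        g (k + 1) w ≤ g k (prefixStr w) + (w (Fin.last k) : ℤ)) ∧
      (G k (prefixStr w) - ((C : ℤ) - (w (Fin.last k) : ℤ)) ≤ G (k + 1) w ∧
        G (k + 1) w ≤ G k (suffixStr w)))
    (hbounds : ∀ k, k ≤ ℓ → ∀ v : Fin k → St C,
      (0 ≤ g k v ∧ g k v ≤ content v) ∧
      (0 ≤ G k v ∧ G k v ≤ ((ℓ - k : ℕ) : ℤ) * C + content v) ∧
      (g k v ≤ G k v ∧ G k v ≤ g k v + ((ℓ - k : ℕ) : ℤ) * C)) :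
    (∀ v : Fin ℓ → St C, g ℓ v = G ℓ v) ∧ IsFlow C ℓ (g ℓ) := by
  have heq : ∀ v : Fin ℓ → St C, g ℓ v = G ℓ v := by
    intro v
    obtain ⟨-, -, h1, h2⟩ := hbounds ℓ le_rfl v
    simp only [Nat.sub_self, Nat.cast_zero, zero_mul, add_zero] at h2
    exact le_antisymm h1 h2
  refine ⟨heq, ?_⟩
  obtain ⟨m, rfl⟩ : ∃ m, ℓ = m + 1 := ⟨ℓ - 1, by omega⟩
  intro w
  obtain ⟨⟨a1, -⟩, -, a4⟩ := hrec m (Nat.lt_succ_self m) (prefixStr w)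
  obtain ⟨⟨-, b2⟩, b3, -⟩ := hrec m (Nat.lt_succ_self m) (suffixStr w)
  have hu : suffixStr (prefixStr w) = prefixStr (suffixStr w) := rfl
  have hl : suffixStr w (Fin.last m) = w (Fin.last (m + 1)) := rfl
  rw [hu] at a1 a4
  rw [hl] at b2 b3
  have e1 := heq (prefixStr w)
  have e2 := heq (suffixStr w)
  constructor <;> linarith
end

section
/- If f and g are flow functions of width ℓ, then the pointwise minimum f ⊓ g (defined by (f ⊓ g)(v) = min{f(v), g(v)}) and the pointwise maximum f ⊔ g (defined by (f ⊔ g)(v) = max{f(v), g(v)}) are also flow functions of width ℓ. Consequently, with the pointwise order, the set of flow functions of width ℓ is a distributive lattice. -/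
/-- Theorem 2 (lattice of flows): the set of flow functions of width `ℓ` is
closed under pointwise minimum and maximum, and consequently, with the
pointwise order, it forms a distributive lattice. -/
theorem flows_distrib_lattice (C ℓ : ℕ) (hC : 1 ≤ C) (hℓ : 1 ≤ ℓ) :
    (∀ f g : (Fin ℓ → St C) → ℤ, IsFlow C ℓ f → IsFlow C ℓ g →
      IsFlow C ℓ (fun v => min (f v) (g v)) ∧ IsFlow C ℓ (fun v => max (f v) (g v))) ∧
    ∃ inst : DistribLattice {f : (Fin ℓ → St C) → ℤ // IsFlow C ℓ f},
      ∀ a b : {f : (Fin ℓ → St C) → ℤ // IsFlow C ℓ f},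
        (letI := inst; a ≤ b) ↔ ∀ v, a.1 v ≤ b.1 v := by
  have key : ∀ f g : (Fin ℓ → St C) → ℤ, IsFlow C ℓ f → IsFlow C ℓ g →
      IsFlow C ℓ (fun v => min (f v) (g v)) ∧ IsFlow C ℓ (fun v => max (f v) (g v)) := by
    intro f g hf hg
    constructor
    · intro w
      have h1 := hf w
      have h2 := hg w
      dsimp only
      omega
    · intro w
      have h1 := hf w
      have h2 := hg w
      dsimp only
      omega
  refine ⟨key, ?_⟩
  let L : Sublattice ((Fin ℓ → St C) → ℤ) :=
    { carrier := {f | IsFlow C ℓ f}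
      supClosed' := fun f hf g hg => (key f g hf hg).2
      infClosed' := fun f hf g hg => (key f g hf hg).1 }
  exact ⟨(inferInstance : DistribLattice L), fun a b => Iff.rfl⟩
end

section
/- Suppose (g_k, G_k)_{0 ≤ k ≤ ℓ} and (h_k, H_k)_{0 ≤ k ≤ ℓ} are two half-flow systems, i.e., sequences of functions Σ^k → ℤ satisfying: for all 0 ≤ k < ℓ and w ∈ Σ^{k+1}, g_k(w_{1:k}) ≤ g_{k+1}(w) ≤ g_k(w_{0:k}) + #w_k and G_k(w_{0:k}) − #^c w_k ≤ G_{k+1}(w) ≤ G_k(w_{1:k}) (and likewise for h, H); and for all 0 ≤ k ≤ ℓ and v ∈ Σ^k, 0 ≤ g_k(v) ≤ #v, 0 ≤ G_k(v) ≤ (ℓ−k)·C + #v, g_k(v) ≤ G_k(v) ≤ g_k(v) + (ℓ−k)·C (and likewise for h, H). Then the componentwise pointwise minimum (min(g_k, h_k), min(G_k, H_k))_{0 ≤ k ≤ ℓ} and the componentwise pointwise maximum (max(g_k, h_k), max(G_k, H_k))_{0 ≤ k ≤ ℓ} are again half-flow systems. -/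
/-- A half-flow system `(g_k, G_k)_{0 ≤ k ≤ ℓ}`: a sequence of pairs of functions
`Σ^k → ℤ` satisfying the inequalities of Lemmas 1 and 2. -/
def IsHalfFlowSys (C ℓ : ℕ) (g G : (k : ℕ) → (Fin k → St C) → ℤ) : Prop :=
  (∀ k, k < ℓ → ∀ w : Fin (k + 1) → St C,
    (g k (suffixStr w) ≤ g (k + 1) w ∧
      g (k + 1) w ≤ g k (prefixStr w) + (w (Fin.last k) : ℤ)) ∧
    (G k (prefixStr w) - ((C : ℤ) - (w (Fin.last k) : ℤ)) ≤ G (k + 1) w ∧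
      G (k + 1) w ≤ G k (suffixStr w))) ∧
  (∀ k, k ≤ ℓ → ∀ v : Fin k → St C,
    (0 ≤ g k v ∧ g k v ≤ content v) ∧
    (0 ≤ G k v ∧ G k v ≤ ((ℓ - k : ℕ) : ℤ) * C + content v) ∧
    (g k v ≤ G k v ∧ G k v ≤ g k v + ((ℓ - k : ℕ) : ℤ) * C))

/-- Theorem 2 for half-flow systems: the componentwise pointwise minimum and
maximum of two half-flow systems are again half-flow systems. -/
theorem half_flow_systems_lattice (C ℓ : ℕ) (hC : 1 ≤ C) (hℓ : 1 ≤ ℓ)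
    (g G h H : (k : ℕ) → (Fin k → St C) → ℤ)
    (hgG : IsHalfFlowSys C ℓ g G) (hhH : IsHalfFlowSys C ℓ h H) :
    IsHalfFlowSys C ℓ (fun k v => min (g k v) (h k v)) (fun k v => min (G k v) (H k v)) ∧
    IsHalfFlowSys C ℓ (fun k v => max (g k v) (h k v)) (fun k v => max (G k v) (H k v)) := by
  obtain ⟨a1, a2⟩ := hgG
  obtain ⟨b1, b2⟩ := hhH
  refine ⟨⟨fun k hk w => ?_, fun k hk v => ?_⟩, ⟨fun k hk w => ?_, fun k hk v => ?_⟩⟩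
  · have x := a1 k hk w
    have y := b1 k hk w
    dsimp only
    omega
  · have x := a2 k hk v
    have y := b2 k hk v
    dsimp only
    generalize ((ℓ - k : ℕ) : ℤ) * (C : ℤ) = m at *
    omega
  · have x := a1 k hk w
    have y := b1 k hk w
    dsimp only
    omega
  · have x := a2 k hk v
    have y := b2 k hk v
    dsimp only
    generalize ((ℓ - k : ℕ) : ℤ) * (C : ℤ) = m at *
    omega
end

section
/- For every a ∈ Σ^ℓ and integer k with 0 ≤ k ≤ #a, the set { f : f is a flow function of width ℓ and f(a) ≥ k } is nonempty (it contains w ↦ #w), and its pointwise minimum m(a, k) is itself a flow function of width ℓ with m(a, k)(a) ≥ k; moreover m(a, k) ≤ f pointwise for every flow function f with f(a) ≥ k. -/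
/-- The minimal flow `m(a, k)`: the pointwise minimum of all flow functions `f`
of width `ℓ` with `f(a) ≥ k`. -/
noncomputable def minFlow (C ℓ : ℕ) (a : Fin ℓ → St C) (k : ℤ) : (Fin ℓ → St C) → ℤ :=
  fun b => sInf {n : ℤ | ∃ f : (Fin ℓ → St C) → ℤ, IsFlow C ℓ f ∧ k ≤ f a ∧ f b = n}

theorem isFlow_content (C ℓ : ℕ) : IsFlow C ℓ (fun w => content w) := by
  intro w
  have h1 := Fin.sum_univ_castSucc (fun i => ((w i : ℕ) : ℤ))
  have h2 := Fin.sum_univ_succ (fun i => ((w i : ℕ) : ℤ))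
  have h3 := (w 0).is_lt
  simp only [content, prefixStr, suffixStr]
  constructor <;> omega

/-- Along any sequence of symbols, a flow function drops by at most `C` per step. -/
theorem IsFlow.drop_le {C ℓ : ℕ} {f : (Fin ℓ → St C) → ℤ} (hf : IsFlow C ℓ f) (s : ℕ → St C)
    (j : ℕ) : f (fun i => s i) - j * C ≤ f (fun i => s (i + j)) := by
  induction j with
  | zero => simp
  | succ j ih =>
    have h := (hf (fun i => s (i + j))).2
    have e1 : prefixStr (fun i : Fin (ℓ + 1) => s (i + j)) = fun i : Fin ℓ => s (i + j) := by
      funext i; simp [prefixStr]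
    have e2 : suffixStr (fun i : Fin (ℓ + 1) => s (i + j)) =
        fun i : Fin ℓ => s (i + (j + 1)) := by
      funext i
      simp only [suffixStr, Fin.val_succ]
      congr 1
      omega
    rw [e1, e2] at h
    push_cast
    have : (0 : ℤ) ≤ ((s ((Fin.last ℓ : Fin (ℓ + 1)) + j) : ℕ) : ℤ) := by positivity
    linarith

theorem IsFlow.lower {C ℓ : ℕ} {f : (Fin ℓ → St C) → ℤ} (hf : IsFlow C ℓ f)
    (a b : Fin ℓ → St C) : f a - ℓ * C ≤ f b := by
  have h := hf.drop_le (fun n => if h : n < ℓ then a ⟨n, h⟩ else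
    if h2 : n - ℓ < ℓ then b ⟨n - ℓ, h2⟩ else 0) ℓ
  simpa using h

/-- The minimal flow `m(a, k)` is well defined: the set of flow functions `f`
with `f(a) ≥ k` is nonempty (it contains `w ↦ #w`), its pointwise minimum
`m(a, k)` is itself a flow function with `m(a, k)(a) ≥ k`, and `m(a, k) ≤ f`
pointwise for every flow function `f` with `f(a) ≥ k`. -/
theorem minFlow_is_minimal_flow (C ℓ : ℕ) (hC : 1 ≤ C) (hℓ : 1 ≤ ℓ)
    (a : Fin ℓ → St C) (k : ℤ) (hk0 : 0 ≤ k) (hka : k ≤ content a) :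
    (IsFlow C ℓ (fun w => content w) ∧ k ≤ content a) ∧
    IsFlow C ℓ (minFlow C ℓ a k) ∧
    k ≤ minFlow C ℓ a k a ∧
    ∀ f : (Fin ℓ → St C) → ℤ, IsFlow C ℓ f → k ≤ f a →
      ∀ b : Fin ℓ → St C, minFlow C ℓ a k b ≤ f b := by
  have hflow := isFlow_content C ℓ
  have hbdd : ∀ b, BddBelow
      {n : ℤ | ∃ f : (Fin ℓ → St C) → ℤ, IsFlow C ℓ f ∧ k ≤ f a ∧ f b = n} := by
    intro b
    refine ⟨k - ℓ * C, ?_⟩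
    rintro n ⟨f, hf, hfa, rfl⟩
    have := hf.lower a b
    linarith
  have hmin : ∀ f : (Fin ℓ → St C) → ℤ, IsFlow C ℓ f → k ≤ f a →
      ∀ b : Fin ℓ → St C, minFlow C ℓ a k b ≤ f b :=
    fun f hf hfa b => csInf_le (hbdd b) ⟨f, hf, hfa, rfl⟩
  have hatt : ∀ b, ∃ f : (Fin ℓ → St C) → ℤ, IsFlow C ℓ f ∧ k ≤ f a ∧
      f b = minFlow C ℓ a k b :=
    fun b => Int.csInf_mem
      (s := {n : ℤ | ∃ f : (Fin ℓ → St C) → ℤ, IsFlow C ℓ f ∧ k ≤ f a ∧ f b = n})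
      ⟨_, _, hflow, hka, rfl⟩ (hbdd b)
  refine ⟨⟨hflow, hka⟩, ?_, ?_, hmin⟩
  · intro w
    obtain ⟨f, hf, hfa, hfe⟩ := hatt (prefixStr w)
    obtain ⟨g, hg, hga, hge⟩ := hatt (suffixStr w)
    have h1 := hmin f hf hfa (suffixStr w)
    have h2 := hmin g hg hga (prefixStr w)
    have h3 := (hf w).1
    have h4 := (hg w).2
    constructor <;> linarith
  · obtain ⟨f, hf, hfa, hfe⟩ := hatt a
    linarith
end

section
/- Every flow function is the pointwise maximum of minimal flows: for every flow function f of width ℓ and every b ∈ Σ^ℓ, f(b) = max{ m(v, f(v))(b) : v ∈ Σ^ℓ }, where m(v, k) denotes the pointwise minimum of all flow functions g of width ℓ with g(v) ≥ k. -/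
/-- Along any bi-infinite word, a flow drops by at most `C` per shift. -/
theorem flow_shift_bound (C ℓ : ℕ) (g : (Fin ℓ → St C) → ℤ) (hg : IsFlow C ℓ g)
    (u : ℕ → St C) (j : ℕ) :
    g (fun i => u i) - j * C ≤ g (fun i => u (i + j)) := by
  induction j with
  | zero => simp
  | succ j ih =>
    have h := (hg (fun i => u (i + j))).2
    have h1 : prefixStr (fun i : Fin (ℓ + 1) => u (i + j)) = fun i : Fin ℓ => u (i + j) := by
      funext i; simp [prefixStr]
    have h2 : suffixStr (fun i : Fin (ℓ + 1) => u (i + j)) =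
        fun i : Fin ℓ => u (i + (j + 1)) := by
      funext i
      simp only [suffixStr, Fin.val_succ]
      congr 1; omega
    rw [h1, h2] at h
    push_cast
    have h3 : (0 : ℤ) ≤ ((u ((Fin.last ℓ : Fin (ℓ + 1)) + j) : St C) : ℕ) := Int.natCast_nonneg _
    linarith

/-- Values of a flow at two words differ by at most `ℓ * C`. -/
theorem flow_lower_bound (C ℓ : ℕ) (g : (Fin ℓ → St C) → ℤ) (hg : IsFlow C ℓ g)
    (v b : Fin ℓ → St C) : g v - ℓ * C ≤ g b := by
  have h := flow_shift_bound C ℓ g hg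
    (fun n => if h : n < ℓ then v ⟨n, h⟩ else if h : n - ℓ < ℓ then b ⟨n - ℓ, h⟩ else 0) ℓ
  simpa using h

/-- Every flow function is the pointwise maximum of minimal flows:
`f(b) = max { m(v, f(v))(b) : v ∈ Σ^ℓ }`. -/
theorem flow_eq_sup_of_minimal_flows (C ℓ : ℕ) (hC : 1 ≤ C) (hℓ : 1 ≤ ℓ)
    (f : (Fin ℓ → St C) → ℤ) (hf : IsFlow C ℓ f) (b : Fin ℓ → St C) :
    f b = Finset.univ.sup' Finset.univ_nonempty
      (fun v : Fin ℓ → St C => minFlow C ℓ v (f v) b) := by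
  apply le_antisymm
  · refine le_trans ?_ (Finset.le_sup' (fun v : Fin ℓ → St C => minFlow C ℓ v (f v) b)
      (Finset.mem_univ b))
    refine le_csInf ⟨f b, f, hf, le_rfl, rfl⟩ ?_
    rintro n ⟨g, _, h, rfl⟩
    exact h
  · refine Finset.sup'_le _ _ fun v _ => ?_
    refine csInf_le ⟨f v - ℓ * C, ?_⟩ ⟨f, hf, le_rfl, rfl⟩
    rintro n ⟨g, hg, h, rfl⟩
    have := flow_lower_bound C ℓ g hg v b
    linarith
end

section
/- Let f be a flow function of width ℓ with f(a) ≥ k for some a ∈ Σ^ℓ and integer k. Then for every b ∈ Σ^ℓ and all strings u, v, w, u', w' over Σ with a = u v w (concatenation) and b = u' v w', one has f(b) ≥ k − min{|u|, |u'|}·C − #w − #^c w', where |·| denotes string length. -/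
/-- Concatenation `u v w` of three strings, recast to length `n`. -/
def cat3 {C p q r n : ℕ} (h : p + q + r = n) (u : Fin p → St C) (v : Fin q → St C)
    (w : Fin r → St C) : Fin n → St C :=
  fun i => Fin.append (Fin.append u v) w (Fin.cast h.symm i)

/-- Window of an infinite sequence. -/
def winOf {C : ℕ} (ℓ : ℕ) (s : ℕ → St C) (n : ℕ) : Fin ℓ → St C := fun i => s (n + i)

/-- Extension of a finite string by zeros. -/
def extStr {C n : ℕ} (u : Fin n → St C) : ℕ → St C := fun i => if h : i < n then u ⟨i, h⟩ else 0

theorem cat3_eq_ext {C p q r n : ℕ} (h : p + q + r = n) (u : Fin p → St C) (v : Fin q → St C)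
    (w : Fin r → St C) (i : Fin n) :
    cat3 h u v w i = if (i : ℕ) < p then extStr u i else
      if (i : ℕ) < p + q then extStr v (i - p) else extStr w (i - (p + q)) := by
  subst h
  unfold cat3
  simp only [Fin.cast_eq_self]
  induction i using Fin.addCases with
  | left i =>
    rw [Fin.append_left]
    induction i using Fin.addCases with
    | left i => rw [Fin.append_left]; simp [extStr]
    | right i => rw [Fin.append_right]; simp [extStr]
  | right i => rw [Fin.append_right]; simp [extStr]; intros; omega

theorem content_eq_ext {C n : ℕ} (w : Fin n → St C) :
    content w = ∑ j ∈ Finset.range n, (extStr w j : ℤ) := by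
  rw [Finset.sum_range]
  simp [content, extStr]

theorem flow_step {C ℓ : ℕ} {f : (Fin ℓ → St C) → ℤ} (hf : IsFlow C ℓ f) (s : ℕ → St C) (n : ℕ) :
    0 ≤ f (winOf ℓ s n) + (s (n + ℓ) : ℤ) - f (winOf ℓ s (n + 1)) ∧
      f (winOf ℓ s n) + (s (n + ℓ) : ℤ) - f (winOf ℓ s (n + 1)) ≤ (C : ℤ) := by
  have := hf (fun i => s (n + i))
  have e : suffixStr (fun i : Fin (ℓ + 1) => s (n + i)) = winOf ℓ s (n + 1) := by
    funext i
    simp only [suffixStr, winOf, Fin.val_succ]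
    congr 1
    omega
  rw [e] at this
  exact this

theorem flow_steps {C ℓ : ℕ} {f : (Fin ℓ → St C) → ℤ} (hf : IsFlow C ℓ f) (s : ℕ → St C) (m : ℕ) :
    f (winOf ℓ s m) ≤ f (winOf ℓ s 0) + ∑ j ∈ Finset.range m, (s (j + ℓ) : ℤ) ∧
    f (winOf ℓ s 0) + ∑ j ∈ Finset.range m, (s (j + ℓ) : ℤ) - m * C ≤ f (winOf ℓ s m) := by
  induction m with
  | zero => simp
  | succ m ih =>
    have := flow_step hf s m
    rw [Finset.sum_range_succ]
    push_cast
    constructor <;> linarith [ih.1, ih.2, this.1, this.2]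

theorem flow_prefix {C ℓ : ℕ} {f : (Fin ℓ → St C) → ℤ} (hf : IsFlow C ℓ f) (p : ℕ)
    (a b : Fin ℓ → St C) (hab : ∀ i : Fin ℓ, p ≤ (i : ℕ) → a i = b i) :
    f a - p * C ≤ f b := by
  have h1 := (flow_steps hf (extStr a) p).2
  have h2 := (flow_steps hf (extStr b) p).1
  have ea : winOf ℓ (extStr a) 0 = a := by funext i; simp [winOf, extStr]
  have eb : winOf ℓ (extStr b) 0 = b := by funext i; simp [winOf, extStr]
  have e : winOf ℓ (extStr a) p = winOf ℓ (extStr b) p := by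
    funext i
    simp only [winOf, extStr]
    split_ifs with hi
    · exact hab _ (by simp)
    · rfl
  rw [ea, e] at h1
  rw [eb] at h2
  simp [extStr] at h1 h2
  linarith

/-- Sequence made of `c` on the first `ℓ` places, followed by `w`. -/
def joinSeq {C : ℕ} (ℓ : ℕ) (c w : ℕ → St C) : ℕ → St C := fun i => if i < ℓ then c i else w (i - ℓ)

theorem flow_base {C ℓ r r' : ℕ} {f : (Fin ℓ → St C) → ℤ} (hf : IsFlow C ℓ f) (c : ℕ → St C)
    (w : Fin r → St C) (w' : Fin r' → St C) :
    f (winOf ℓ (joinSeq ℓ c (extStr w)) r) - content w - (r' * C - content w') ≤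
      f (winOf ℓ (joinSeq ℓ c (extStr w')) r') := by
  have h1 := (flow_steps hf (joinSeq ℓ c (extStr w)) r).1
  have h2 := (flow_steps hf (joinSeq ℓ c (extStr w')) r').2
  have e : winOf ℓ (joinSeq ℓ c (extStr w)) 0 = winOf ℓ (joinSeq ℓ c (extStr w')) 0 := by
    funext i; simp [winOf, joinSeq]
  rw [e] at h1
  rw [content_eq_ext, content_eq_ext]
  simp only [joinSeq, Nat.not_lt.mpr (Nat.le_add_left _ _), if_false, Nat.add_sub_cancel] at h1 h2
  linarith

/-- Theorem 3, necessity: if `f` is a flow function with `f(a) ≥ k`, then for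
every `b` and all decompositions `a = u v w`, `b = u' v w'`, one has
`f(b) ≥ k − min{|u|, |u'|}·C − #w − #^c w'`. -/
theorem minimal_flow_lower_bound (C ℓ : ℕ) (hC : 1 ≤ C) (hℓ : 1 ≤ ℓ)
    (f : (Fin ℓ → St C) → ℤ) (hf : IsFlow C ℓ f) (k : ℤ)
    (p q r p' r' : ℕ) (h : p + q + r = ℓ) (h' : p' + q + r' = ℓ)
    (u : Fin p → St C) (v : Fin q → St C) (w : Fin r → St C)
    (u' : Fin p' → St C) (w' : Fin r' → St C)
    (ha : k ≤ f (cat3 h u v w)) :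
    k - (min p p' : ℤ) * C - content w - ((r' : ℤ) * C - content w') ≤ f (cat3 h' u' v w') := by
  have key : ∀ (p₀ r₀ : ℕ) (x : Fin p₀ → St C) (h₀ : p₀ + q + r₀ = ℓ) (p₁ r₁ : ℕ)
      (h₁ : p₁ + q + r₁ = ℓ) (y : Fin p₁ → St C) (z : Fin r₁ → St C) (i : Fin ℓ),
      (p₁ ≤ (i : ℕ) ∨ (p₁ = p₀ ∧ HEq x y)) →
      winOf ℓ (joinSeq ℓ (fun i => if i < r₀ then 0 else if i < r₀ + p₀ then extStr x (i - r₀)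
        else extStr v (i - (r₀ + p₀))) (extStr z)) r₁ i = cat3 h₁ y v z i := by
    intro p₀ r₀ x h₀ p₁ r₁ h₁ y z i hi
    have hi2 := i.2
    rw [cat3_eq_ext]
    simp only [winOf, joinSeq]
    by_cases hp : (i : ℕ) < p₁
    · obtain hi | ⟨rfl, hxy⟩ := hi
      · omega
      obtain rfl := eq_of_heq hxy
      obtain rfl : r₁ = r₀ := by omega
      rw [if_pos (by omega), if_neg (by omega), if_pos (by omega), if_pos hp]
      congr 1
      omega
    · rw [if_neg hp]
      by_cases hq : (i : ℕ) < p₁ + q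
      · rw [if_pos (by omega), if_neg (by omega), if_neg (by omega), if_pos hq]
        congr 1
        omega
      · rw [if_neg (by omega), if_neg hq]
        congr 1
        omega
  rcases le_total p' p with hpp | hpp
  · have hb := flow_base hf (fun i => if i < r then 0 else if i < r + p then extStr u (i - r)
        else extStr v (i - (r + p))) w w'
    have e := funext fun i => key p r u h p r h u w i (Or.inr ⟨rfl, HEq.rfl⟩)
    have g := flow_prefix hf p' _ _ fun i hi => key p r u h p' r' h' u' w' i (Or.inl hi)
    rw [e] at hb
    rw [min_eq_right (by exact_mod_cast hpp)]
    linarith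
  · have hb := flow_base hf (fun i => if i < r' then 0 else if i < r' + p' then extStr u' (i - r')
        else extStr v (i - (r' + p'))) w w'
    have e := funext fun i => key p' r' u' h' p' r' h' u' w' i (Or.inr ⟨rfl, HEq.rfl⟩)
    have g := flow_prefix hf p _ _ fun i hi => (key p' r' u' h' p r h u w i (Or.inl hi)).symm
    rw [e] at hb
    rw [min_eq_left (by exact_mod_cast hpp)]
    linarith
end

section
/- For C = 1 and ℓ = 4 (so Σ = {0, 1}), the pointwise order on flow functions of width 4 is not a linear order: the minimal flows f = m((0,1,0,1), 2) and g = m((0,0,1,1), 2) are incomparable, i.e., neither f(v) ≤ g(v) for all v ∈ Σ⁴ nor g(v) ≤ f(v) for all v ∈ Σ⁴. In particular f((0,1,0,1)) = 2 > g((0,1,0,1)) and g((0,0,1,1)) = 2 > f((0,0,1,1)). -/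
/-- Index of a binary string of length 4, read as a binary number. -/
def strIdx (v : Fin 4 → St 1) : ℕ :=
  8 * (v 0).val + 4 * (v 1).val + 2 * (v 2).val + (v 3).val

/-- The flow `m(0101, 2)`, as a table. -/
def flowF (v : Fin 4 → St 1) : ℤ :=
  ([0, 1, 1, 1, 0, 2, 1, 2, 0, 1, 1, 2, 0, 1, 1, 2] : List ℤ).getD (strIdx v) 0

/-- The flow `m(0011, 2)`, as a table. -/
def flowG (v : Fin 4 → St 1) : ℤ :=
  ([0, 1, 0, 2, 0, 0, 1, 2, 0, 1, 0, 1, 0, 1, 1, 2] : List ℤ).getD (strIdx v) 0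

theorem isFlow_flowF : IsFlow 1 4 flowF := by
  unfold IsFlow; decide +kernel

theorem isFlow_flowG : IsFlow 1 4 flowG := by
  unfold IsFlow; decide +kernel

/-- One step along a string costs at most one unit of flow. -/
theorem flow_step_s18 {f : (Fin 4 → St 1) → ℤ} (hf : IsFlow 1 4 f) (a b c d e : St 1) :
    f ![a, b, c, d] - 1 ≤ f ![b, c, d, e] := by
  have h := (hf ![a, b, c, d, e]).2
  have h1 : prefixStr ![a, b, c, d, e] = ![a, b, c, d] := by
    funext i; fin_cases i <;> rfl
  have h2 : suffixStr ![a, b, c, d, e] = ![b, c, d, e] := by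
    funext i; fin_cases i <;> rfl
  rw [h1, h2] at h
  have h3 : (0 : ℤ) ≤ (((![a, b, c, d, e] : Fin 5 → St 1) (Fin.last 4)).val : ℤ) :=
    Int.natCast_nonneg _
  push_cast at h
  linarith

theorem flow_lower {f : (Fin 4 → St 1) → ℤ} (hf : IsFlow 1 4 f) (a b c d p q r s : St 1) :
    f ![a, b, c, d] - 4 ≤ f ![p, q, r, s] := by
  have h1 := flow_step_s18 hf a b c d p
  have h2 := flow_step_s18 hf b c d p q
  have h3 := flow_step_s18 hf c d p q r
  have h4 := flow_step_s18 hf d p q r s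
  linarith

/-- The infimum defining the minimal flow is over a set bounded below, so it is at most the
value of any competitor. -/
theorem minFlow_le {f : (Fin 4 → St 1) → ℤ} (hf : IsFlow 1 4 f) (k : ℤ)
    (a b c d p q r s : St 1) (hk : k ≤ f ![a, b, c, d]) :
    minFlow 1 4 ![a, b, c, d] k ![p, q, r, s] ≤ f ![p, q, r, s] := by
  refine csInf_le ⟨k - 4, ?_⟩ ⟨f, hf, hk, rfl⟩
  rintro n ⟨g, hg, hgk, rfl⟩
  have := flow_lower hg a b c d p q r s
  linarith

theorem minFlow_self {f : (Fin 4 → St 1) → ℤ} (hf : IsFlow 1 4 f) (k : ℤ)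
    (a b c d : St 1) (hk : f ![a, b, c, d] = k) :
    minFlow 1 4 ![a, b, c, d] k ![a, b, c, d] = k := by
  apply le_antisymm
  · exact (minFlow_le hf k a b c d a b c d hk.ge).trans hk.le
  · refine le_csInf ⟨k, f, hf, hk.ge, hk⟩ ?_
    rintro n ⟨g, -, hgk, rfl⟩
    exact hgk

/-- For `C = 1` and `ℓ = 4`, the pointwise order on flow functions of width 4 is
not linear: the minimal flows `m(0101, 2)` and `m(0011, 2)` are incomparable. -/
theorem minimal_flows_incomparable :
    (¬ ∀ v : Fin 4 → St 1, minFlow 1 4 ![0, 1, 0, 1] 2 v ≤ minFlow 1 4 ![0, 0, 1, 1] 2 v) ∧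
    (¬ ∀ v : Fin 4 → St 1, minFlow 1 4 ![0, 0, 1, 1] 2 v ≤ minFlow 1 4 ![0, 1, 0, 1] 2 v) ∧
    minFlow 1 4 ![0, 1, 0, 1] 2 ![0, 1, 0, 1] = 2 ∧
    minFlow 1 4 ![0, 0, 1, 1] 2 ![0, 1, 0, 1] < 2 ∧
    minFlow 1 4 ![0, 0, 1, 1] 2 ![0, 0, 1, 1] = 2 ∧
    minFlow 1 4 ![0, 1, 0, 1] 2 ![0, 0, 1, 1] < 2 := by
  have hF := minFlow_self isFlow_flowF 2 0 1 0 1 (by decide)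
  have hG := minFlow_self isFlow_flowG 2 0 0 1 1 (by decide)
  have hFG : minFlow 1 4 ![0, 1, 0, 1] 2 ![0, 0, 1, 1] < 2 :=
    (minFlow_le isFlow_flowF 2 0 1 0 1 0 0 1 1 (by decide)).trans_lt (by decide)
  have hGF : minFlow 1 4 ![0, 0, 1, 1] 2 ![0, 1, 0, 1] < 2 :=
    (minFlow_le isFlow_flowG 2 0 0 1 1 0 1 0 1 (by decide)).trans_lt (by decide)
  refine ⟨fun h => ?_, fun h => ?_, hF, hGF, hG, hFG⟩
  · have := h ![0, 1, 0, 1]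
    linarith
  · have := h ![0, 0, 1, 1]
    linarith
end
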